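/- For every ε > 0 there exists δ > 0 with the following property: whenever A is a C*-algebra, p, q ∈ A are projections, and x ∈ A satisfies ‖x*x − p‖ < δ, ‖xx* − q‖ < δ, and ‖qxp − x‖ < δ, then there exists a partial isometry v ∈ A such that v*v = p, vv* = q, and ‖x − v‖ < ε. -/

import Mathlib

/-- A projection in a C*-algebra: a self-adjoint idempotent. -/
def IsProjection {A : Type*} [NonUnitalCStarAlgebra A] (p : A) : Prop :=
  IsSelfAdjoint p ∧ p * p = p

lemma exists_commuting_sqrt_inv_of_norm_sub_one_lt {B : Type*} [CStarAlgebra B] {a : B}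
    (ha : IsSelfAdjoint a) (h1 : ‖a - 1‖ < 1) :
    ∃ h c : B, IsSelfAdjoint c ∧ h * h = a ∧ c * h = 1 ∧ (∀ b, Commute a b → Commute c b) ∧
      ‖1 - h‖ ≤ ‖a - 1‖ := by
  have hspec : ∀ t ∈ spectrum ℝ a, |t - 1| ≤ ‖a - 1‖ := by
    intro t ht
    have key := norm_apply_le_norm_cfc (fun t : ℝ => t - 1) a ht
    rwa [cfc_sub (fun t : ℝ => t) (fun _ => 1) a, cfc_id' ℝ a, cfc_const_one ℝ a] at key
  have hpos : ∀ t ∈ spectrum ℝ a, 0 < t := fun t ht => by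
    linarith [(abs_le.mp (hspec t ht)).1]
  have hinv : ContinuousOn (fun t : ℝ => (√t)⁻¹) (spectrum ℝ a) :=
    Real.continuous_sqrt.continuousOn.inv₀ fun t ht => (Real.sqrt_pos.mpr (hpos t ht)).ne'
  refine ⟨cfc Real.sqrt a, cfc (fun t : ℝ => (√t)⁻¹) a, cfc_predicate _ a, ?_, ?_, ?_, ?_⟩
  · rw [← cfc_mul Real.sqrt Real.sqrt a]
    conv_rhs => rw [← cfc_id ℝ a]
    exact cfc_congr fun t ht => Real.mul_self_sqrt (hpos t ht).le
  · rw [← cfc_mul (fun t : ℝ => (√t)⁻¹) Real.sqrt a, ← cfc_one ℝ a]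
    exact cfc_congr fun t ht => inv_mul_cancel₀ (Real.sqrt_pos.mpr (hpos t ht)).ne'
  · exact fun b hb => hb.cfc_real _
  · rw [← cfc_one ℝ a, ← cfc_sub (1 : ℝ → ℝ) Real.sqrt a]
    refine norm_cfc_le (norm_nonneg _) fun t ht => ?_
    rw [cfc_one ℝ a]
    refine le_trans ?_ (hspec t ht)
    have hs := Real.sqrt_nonneg t
    have hfac : t - 1 = (√t - 1) * (√t + 1) := by
      nlinarith [Real.mul_self_sqrt (hpos t ht).le]
    rw [Pi.one_apply, Real.norm_eq_abs, abs_sub_comm, hfac, abs_mul]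
    exact le_mul_of_one_le_right (abs_nonneg _) (by rw [abs_of_nonneg] <;> linarith)

lemma exists_mul_partial_isometry_of_norm_lt {B : Type*} [CStarAlgebra B] {p q y : B}
    (hp : IsStarProjection p) (hq : IsStarProjection q) (hyp : y * p = y) (hqy : q * y = y)
    (h1 : ‖star y * y - p‖ < 1) (h2 : ‖y * star y - q‖ < 1) :
    ∃ c : B, star (y * c) * (y * c) = p ∧ (y * c) * star (y * c) = q ∧
      ‖y - y * c‖ ≤ ‖star y * y - p‖ := by
  have hps : star p = p := hp.isSelfAdjoint
  have hqs : star q = q := hq.isSelfAdjoint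
  have hpp : p * p = p := hp.isIdempotentElem
  have hqq : q * q = q := hq.isIdempotentElem
  have hpy : p * star y = star y := by simpa [hps] using congrArg star hyp
  have hyq : star y * q = star y := by simpa [hqs] using congrArg star hqy
  set a : B := star y * y + (1 - p) with ha
  have ha1 : a - 1 = star y * y - p := by rw [ha]; abel
  have hap : a * p = star y * y := by
    rw [ha, add_mul, mul_assoc, hyp, sub_mul, hpp, one_mul, sub_self, add_zero]
  have hpa : p * a = star y * y := by
    rw [ha, mul_add, ← mul_assoc, hpy, mul_sub, hpp, mul_one, sub_self, add_zero]
  have has : IsSelfAdjoint a := by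
    simp [ha, isSelfAdjoint_iff, hps]
  obtain ⟨h, c, hc, hh, hch, hcomm, hnorm⟩ :=
    exists_commuting_sqrt_inv_of_norm_sub_one_lt has (ha1 ▸ h1)
  have hcs : star c = c := hc
  have hca : c * a = a * c := hcomm a (Commute.refl a)
  have hcp : c * p = p * c := hcomm p (hap.trans hpa.symm)
  have hcca : c * (c * a) = 1 := by
    rw [← hh, ← mul_assoc c h h, hch, one_mul, hch]
  have hv : star (y * c) * (y * c) = p := by
    calc star (y * c) * (y * c) = c * ((star y * y) * c) := by
          simp only [star_mul, hcs, mul_assoc]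
      _ = c * (c * a) * p := by
          rw [← hap, mul_assoc a p c, ← hcp, ← mul_assoc a c p, ← hca]
          simp only [mul_assoc]
      _ = p := by rw [hcca, one_mul]
  refine ⟨c, hv, ?_, ?_⟩
  · have hstar : star (y * c) = c * star y := by rw [star_mul, hcs]
    have hunit : IsUnit (y * star y + (1 - q)) := by
      have := isUnit_one_sub_of_norm_lt_one (x := q - y * star y) (by rwa [norm_sub_rev])
      convert this using 1
      abel
    have hey : (y * c) * star (y * c) * y = y := by
      calc (y * c) * star (y * c) * y = y * (c * (c * (star y * y))) := by
            simp only [hstar, mul_assoc]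
        _ = y * (c * (c * a) * p) := by rw [← hap]; simp only [mul_assoc]
        _ = y := by rw [hcca, one_mul, hyp]
    have heq : (y * c) * star (y * c) * q = (y * c) * star (y * c) := by
      simp only [hstar, mul_assoc, hyq]
    refine hunit.mul_right_cancel ?_
    rw [mul_add, mul_add, ← mul_assoc _ y, hey, mul_sub, heq, mul_one, sub_self, add_zero,
      ← mul_assoc q y, hqy, mul_sub, hqq, mul_one, sub_self, add_zero]
  · have hv1 : ‖y * c‖ ≤ 1 := by
      have := CStarRing.norm_star_mul_self (x := y * c)
      rw [hv] at this
      nlinarith [hp.norm_le, norm_nonneg (y * c)]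
    calc ‖y - y * c‖ = ‖y * c * (1 - h)‖ := by
          rw [mul_sub, mul_assoc y c h, hch, mul_one, mul_one, norm_sub_rev]
      _ ≤ ‖y * c‖ * ‖1 - h‖ := norm_mul_le _ _
      _ ≤ 1 * ‖1 - h‖ := by gcongr
      _ ≤ ‖star y * y - p‖ := by rw [one_mul, ← ha1]; exact hnorm

lemma exists_partial_isometry_of_norm_lt {A : Type*} [NonUnitalCStarAlgebra A] {p q y : A}
    (hp : IsStarProjection p) (hq : IsStarProjection q) (hyp : y * p = y) (hqy : q * y = y)
    (h1 : ‖star y * y - p‖ < 1) (h2 : ‖y * star y - q‖ < 1) :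
    ∃ v : A, star v * v = p ∧ v * star v = q ∧ ‖y - v‖ ≤ ‖star y * y - p‖ := by
  let ι := Unitization.inrNonUnitalStarAlgHom ℂ A
  have hι : ∀ b : A, ‖ι b‖ = ‖b‖ := Unitization.norm_inr
  have hinj : Function.Injective ι := Unitization.inr_injective
  obtain ⟨c, hc1, hc2, hc3⟩ := exists_mul_partial_isometry_of_norm_lt (y := ι y)
    (hp.map ι) (hq.map ι) (by rw [← map_mul, hyp]) (by rw [← map_mul, hqy])
    (by rwa [← map_star, ← map_mul, ← map_sub, hι])
    (by rwa [← map_star, ← map_mul, ← map_sub, hι])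
  have hv : ι y * c = ι (c.fst • y + y * c.snd) := by
    ext <;> simp [ι]
  rw [hv] at hc1 hc2 hc3
  refine ⟨c.fst • y + y * c.snd, hinj ?_, hinj ?_, ?_⟩
  · rw [map_mul, map_star, hc1]
  · rw [map_mul, map_star, hc2]
  · rwa [← map_star, ← map_mul, ← map_sub, ← map_sub, hι, hι] at hc3

lemma norm_mul_sub_mul_le {R : Type*} [NonUnitalSeminormedRing R] (a b c d : R) :
    ‖a * b - c * d‖ ≤ ‖a - c‖ * ‖b‖ + ‖c‖ * ‖b - d‖ := by
  have : a * b - c * d = (a - c) * b + c * (b - d) := by noncomm_ring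
  rw [this]
  exact (norm_add_le _ _).trans (add_le_add (norm_mul_le _ _) (norm_mul_le _ _))

/-- Lemma 2.11: for every `ε > 0` there is `δ > 0` such that in any C*-algebra `A`, whenever
`p, q` are projections and `x` satisfies `‖x*x − p‖ < δ`, `‖xx* − q‖ < δ` and `‖qxp − x‖ < δ`,
there is a partial isometry `v` with `v*v = p`, `vv* = q` and `‖x − v‖ < ε`. -/
theorem almost_partial_isometry_near.{u} :
    ∀ ε : ℝ, 0 < ε → ∃ δ : ℝ, 0 < δ ∧
      ∀ (A : Type u) [NonUnitalCStarAlgebra A], ∀ p q x : A,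
        IsProjection p → IsProjection q →
        ‖star x * x - p‖ < δ → ‖x * star x - q‖ < δ → ‖q * x * p - x‖ < δ →
        ∃ v : A, star v * v = p ∧ v * star v = q ∧ ‖x - v‖ < ε := by
  intro ε hε
  refine ⟨min (1 / 8) (ε / 8), by positivity, ?_⟩
  intro A _ p q x hp hq h1 h2 h3
  set δ := min (1 / 8) (ε / 8)
  have hδ1 : δ ≤ 1 / 8 := min_le_left _ _
  have hδ2 : δ ≤ ε / 8 := min_le_right _ _
  have hp' : IsStarProjection p := ⟨hp.2, hp.1⟩
  have hq' : IsStarProjection q := ⟨hq.2, hq.1⟩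
  set y := q * x * p with hy
  have hx : ‖x‖ ≤ 2 := by
    have hxx := CStarRing.norm_star_mul_self (x := x)
    have htri := norm_le_norm_sub_add (star x * x) p
    nlinarith [hp'.norm_le, norm_nonneg x]
  have hyn : ‖y‖ ≤ 3 := by
    linarith [norm_le_norm_sub_add y x]
  have hstar : ‖star y - star x‖ = ‖y - x‖ := by rw [← star_sub, norm_star]
  have hyy : ‖star y * y - p‖ < 6 * δ := by
    have hd := norm_mul_sub_mul_le (star y) y (star x) x
    rw [hstar, norm_star] at hd
    have htri := norm_sub_le_norm_sub_add_norm_sub (star y * y) (star x * x) p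
    nlinarith [norm_nonneg (y - x)]
  have hyy' : ‖y * star y - q‖ < 6 * δ := by
    have hd := norm_mul_sub_mul_le y (star y) x (star x)
    rw [hstar, norm_star] at hd
    have htri := norm_sub_le_norm_sub_add_norm_sub (y * star y) (x * star x) q
    nlinarith [norm_nonneg (y - x)]
  obtain ⟨v, hv1, hv2, hv3⟩ := exists_partial_isometry_of_norm_lt (y := y) hp' hq'
    (by rw [hy, mul_assoc, hp.2]) (by rw [hy, ← mul_assoc, ← mul_assoc, hq.2])
    (by linarith) (by linarith)
  refine ⟨v, hv1, hv2, ?_⟩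
  have htri := norm_sub_le_norm_sub_add_norm_sub x y v
  rw [norm_sub_rev x y] at htri
  linarith
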